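/- arXiv:1409.7544 — 2 statements merged into one kernel-verified Lean document; each statement's English description precedes it below -/
import Mathlib

section
/- Let q be a prime power, n ≥ 1 an integer, and F ∈ F_q[x_0, …, x_n] a nonzero homogeneous polynomial of degree δ ≥ 1. Then the number of points [v] of the projective space ℙ(F_q^{n+1}) (the projectivization of the vector space F_q^{n+1}) such that F(v) = 0 for some (equivalently, every) representative v is at most δ·q^{n-1} + (q^{n-1} − 1)/(q − 1). -/
open MvPolynomial Finset

section HomogeneousZeros

variable {K : Type*} [Field K]

theorem MvPolynomial.IsHomogeneous.eval_smul_eq {σ : Type*} {F : MvPolynomial σ K} {d : ℕ}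
    (hF : F.IsHomogeneous d) (c : K) (v : σ → K) :
    eval (c • v) F = c ^ d * eval v F := by
  rw [eval_eq, eval_eq, Finset.mul_sum]
  refine Finset.sum_congr rfl fun m hm => ?_
  have hm' : ∑ i ∈ m.support, m i = d := by
    have h := hF (mem_support_iff.1 hm)
    simpa [Finsupp.weight_apply, Finsupp.sum] using h
  simp only [Pi.smul_apply, smul_eq_mul, mul_pow, Finset.prod_mul_distrib,
    Finset.prod_pow_eq_pow_sum]
  rw [hm']
  ring

/-- Homogeneous polynomials can be pulled back along linear maps. -/
theorem MvPolynomial.IsHomogeneous.exists_eval_comp {σ τ : Type*} [Fintype τ] [DecidableEq τ]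
    {F : MvPolynomial σ K} {d : ℕ} (hF : F.IsHomogeneous d) (A : (τ → K) →ₗ[K] (σ → K)) :
    ∃ G : MvPolynomial τ K, G.IsHomogeneous d ∧ ∀ x, eval x G = eval (A x) F := by
  refine ⟨MvPolynomial.aeval (fun i => ∑ j, C (A (Pi.single j 1) i) * X j) F, ?_, fun x => ?_⟩
  · have h := hF.aeval (fun i => ∑ j, C (A (Pi.single j 1) i) * (X j : MvPolynomial τ K))
      (n := 1) fun i => IsHomogeneous.sum _ _ _ fun j _ => by
        simpa using (isHomogeneous_C τ (A (Pi.single j 1) i)).mul (isHomogeneous_X K j)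
    simpa using h
  · have hA : (fun i => eval x (∑ j, C (A (Pi.single j 1) i) * (X j : MvPolynomial τ K)))
        = A x := by
      ext i
      conv_rhs => rw [← Finset.univ_sum_single x]
      simp only [map_sum, map_mul, eval_C, eval_X, Finset.sum_apply]
      refine Finset.sum_congr rfl fun j _ => ?_
      have : (Pi.single j (x j) : τ → K) = x j • Pi.single j 1 := by
        rw [← Pi.single_smul]; simp
      rw [this, map_smul, Pi.smul_apply, smul_eq_mul, mul_comm]
    rw [← hA, MvPolynomial.aeval_def, eval_eval₂]
    simp only [eval, MvPolynomial.algebraMap_eq, coe_eval₂Hom]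
    congr 1
    ext; simp

theorem exists_linearEquiv_dotProduct_eq {n : ℕ} {a : Fin (n + 1) → K} (ha : a ≠ 0) :
    ∃ A : (Fin (n + 1) → K) ≃ₗ[K] (Fin (n + 1) → K), ∀ x, a ⬝ᵥ A x = x 0 := by
  let f : Module.Dual K (Fin (n + 1) → K) := dotProductBilin K K a
  have hf (x) : f x = a ⬝ᵥ x := rfl
  have hf0 : f ≠ 0 := fun h => ha (dotProduct_eq_zero a fun w => by rw [← hf, h]; rfl)
  have hrank : Module.finrank K (LinearMap.ker f) = Module.finrank K (Fin n → K) := by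
    have := Module.Dual.finrank_ker_add_one_of_ne_zero hf0
    simpa using this
  let e := LinearEquiv.ofFinrankEq _ _ hrank
  obtain ⟨u, hu⟩ := LinearMap.surjective hf0 1
  let A : (Fin (n + 1) → K) →ₗ[K] (Fin (n + 1) → K) :=
    (LinearMap.proj 0).smulRight u +
      (LinearMap.ker f).subtype ∘ₗ e.symm.toLinearMap ∘ₗ LinearMap.funLeft K K Fin.succ
  have hA (x) : A x = x 0 • u + (e.symm fun i => x i.succ : LinearMap.ker f) := rfl
  have hfA (x) : f (A x) = x 0 := by
    rw [hA, map_add, map_smul, hu, LinearMap.mem_ker.1 (Subtype.prop _)]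
    simp
  have hinj : Function.Injective A := by
    rw [injective_iff_map_eq_zero]
    intro x hx
    have h0 : x 0 = 0 := by rw [← hfA x, hx, map_zero]
    have h1 : (fun i : Fin n => x i.succ) = 0 := by
      rw [hA, h0, zero_smul, zero_add] at hx
      exact (LinearEquiv.map_eq_zero_iff e.symm).1 (Subtype.ext hx)
    ext i
    exact Fin.cases h0 (congrFun h1) i
  exact ⟨LinearEquiv.ofInjectiveEndo A hinj, hfA⟩

theorem card_filter_eq_sum_card_cons {K : Type*} [Fintype K] {n : ℕ} (p : (Fin (n + 1) → K) → Prop)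
    [DecidablePred p] :
    #{v | p v} = ∑ c : K, #{s : Fin n → K | p (Fin.cons c s)} := by
  simp only [Finset.card_filter]
  rw [← (Fin.consEquiv fun _ => K).sum_comp, Fintype.sum_prod_type]
  rfl

theorem card_filter_apply_zero_eq_zero_and [Fintype K] [DecidableEq K] {n : ℕ}
    (p : (Fin (n + 1) → K) → Prop) [DecidablePred p] :
    #{v | p v ∧ v 0 = 0} = #{s : Fin n → K | p (Fin.cons 0 s)} := by
  rw [card_filter_eq_sum_card_cons, Finset.sum_eq_single 0]
  · simp
  · intro c _ hc
    simp [hc]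
  · simp

theorem card_filter_dotProduct_eq_zero [Fintype K] [DecidableEq K] {n : ℕ}
    {a : Fin (n + 1) → K} (ha : a ≠ 0) :
    #{v | a ⬝ᵥ v = 0} = Fintype.card K ^ n := by
  obtain ⟨A, hA⟩ := exists_linearEquiv_dotProduct_eq ha
  have h := card_filter_apply_zero_eq_zero_and (K := K) (n := n) fun _ => True
  simp only [true_and, Finset.filter_true, Finset.card_univ, Fintype.card_fun,
    Fintype.card_fin] at h
  rw [← h]
  refine (Finset.card_equiv A.toEquiv fun v => ?_).symm
  simp [hA]

theorem card_zeros_mul_card_le [Fintype K] [DecidableEq K] {n : ℕ} {p : MvPolynomial (Fin n) K}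
    (hp : p ≠ 0) :
    #{s | eval s p = 0} * Fintype.card K ≤ p.totalDegree * Fintype.card K ^ n := by
  have h := schwartz_zippel_totalDegree hp (Finset.univ : Finset K)
  have hK : (0 : ℚ≥0) < Fintype.card K := by exact_mod_cast Fintype.card_pos
  rw [Fintype.piFinset_univ, Finset.card_univ, div_le_div_iff₀ (by positivity) hK] at h
  exact_mod_cast h

/-- A homogeneous form vanishing on the hyperplane `x₀ = 0` has at most `d - 1` times the
expected number of zeros on each other slice `x₀ = c`. -/
theorem card_zeros_cons_mul_card_le [Fintype K] [DecidableEq K] {n d : ℕ}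
    {F : MvPolynomial (Fin (n + 1)) K} (hF : F ≠ 0) (hd : d ≤ Fintype.card K)
    (hhom : F.IsHomogeneous d) (h0 : (finSuccEquiv K n F).coeff 0 = 0) {c : K} (hc : c ≠ 0) :
    #{s | eval (Fin.cons c s : Fin (n + 1) → K) F = 0} * Fintype.card K
      ≤ (d - 1) * Fintype.card K ^ n := by
  set L : MvPolynomial (Fin n) K := (finSuccEquiv K n F).eval (C c) with hL
  have heval (s : Fin n → K) : eval (Fin.cons c s : Fin (n + 1) → K) F = eval s L := by
    rw [eval_eq_eval_mv_eval', hL, Polynomial.eval_map, Polynomial.eval_eq_sum,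
      Polynomial.eval₂_eq_sum, Polynomial.sum, Polynomial.sum, map_sum]
    simp
  have hdeg : L.totalDegree ≤ d - 1 := by
    rw [hL, Polynomial.eval_eq_sum, Polynomial.sum]
    refine totalDegree_finsetSum_le fun i hi => ?_
    rw [Polynomial.mem_support_iff] at hi
    have hi0 : i ≠ 0 := by rintro rfl; exact hi h0
    have h1 := (totalDegree_coeff_finSuccEquiv_add_le F i hi).trans hhom.totalDegree_le
    refine (totalDegree_mul _ _).trans ?_
    rw [← C_pow, totalDegree_C]
    omega
  have hL0 : L ≠ 0 := by
    intro hLz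
    refine hF (hhom.eq_zero_of_forall_eval_eq_zero_of_le_card (fun v => ?_) ?_)
    · obtain ⟨x, s, rfl⟩ : ∃ (x : K) (s : Fin n → K), v = Fin.cons x s :=
        ⟨v 0, Fin.tail v, (Fin.cons_self_tail v).symm⟩
      by_cases hx : x = 0
      · rw [hx, eval_eq_eval_mv_eval', ← Polynomial.coeff_zero_eq_eval_zero,
          Polynomial.coeff_map, h0, map_zero]
      · have h := hhom.eval_smul_eq (c / x) (Fin.cons x s)
        have hcons : (c / x) • (Fin.cons x s : Fin (n + 1) → K) = Fin.cons c ((c / x) • s) := by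
          ext i
          refine Fin.cases ?_ (fun j => ?_) i <;> simp [hx]
        rw [hcons, heval, hLz, map_zero] at h
        exact (mul_eq_zero.1 h.symm).resolve_left (pow_ne_zero _ (div_ne_zero hc hx))
    · simpa using hd
  simp only [heval]
  exact (card_zeros_mul_card_le hL0).trans (Nat.mul_le_mul_right _ hdeg)

/-- Double counting of incidences between a set of vectors and the linear hyperplanes. -/
theorem sum_card_filter_dotProduct [Fintype K] [DecidableEq K] {n : ℕ}
    {Z : Finset (Fin (n + 1) → K)} (hZ : 0 ∈ Z) :
    ∑ a ∈ univ.erase 0, #{v ∈ Z | a ⬝ᵥ v = 0}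
      = (#Z - 1) * (Fintype.card K ^ n - 1) + (Fintype.card K ^ (n + 1) - 1) := by
  simp only [Finset.card_filter]
  rw [Finset.sum_comm, ← Finset.sum_erase_add _ _ hZ]
  congr 1
  · rw [← Finset.card_erase_of_mem hZ, ← smul_eq_mul, ← Finset.sum_const]
    refine Finset.sum_congr rfl fun v hv => ?_
    rw [← Finset.card_filter, Finset.filter_erase, Finset.card_erase_of_mem (by simp)]
    simp only [dotProduct_comm _ v]
    rw [card_filter_dotProduct_eq_zero (Finset.ne_of_mem_erase hv)]
  · simp

theorem le_of_incidence_le {q Q C M : ℕ} (hq : 1 < q) (hQ : 0 < Q) (hM : M ≤ q ^ 2)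
    (h : q * ((C - 1) * (q * Q - 1) + (q ^ 2 * Q - 1)) ≤ (q ^ 2 * Q - 1) * (Q * M)) :
    C ≤ Q * M := by
  by_contra! hC
  obtain ⟨e, rfl⟩ : ∃ e, C = Q * M + 1 + e := ⟨C - (Q * M + 1), by omega⟩
  have h1 : 1 ≤ q * Q := by nlinarith
  have h2 : 1 ≤ q ^ 2 * Q := by nlinarith
  rw [show Q * M + 1 + e - 1 = Q * M + e by omega] at h
  zify [h1, h2] at h hM hq hQ
  have h3 : (0 : ℤ) ≤ q * e * (q * Q - 1) := by
    have : (1 : ℤ) ≤ q * Q := by exact_mod_cast h1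
    have : (0 : ℤ) ≤ q * Q - 1 := by linarith
    positivity
  have h4 : (Q : ℤ) * M * (q - 1) ≤ Q * q ^ 2 * (q - 1) := by
    have : (0 : ℤ) ≤ q - 1 := by linarith
    gcongr
  nlinarith

theorem mul_card_zeros_le [Fintype K] [DecidableEq K] {d : ℕ} (hd : 1 ≤ d)
    (hdK : d ≤ Fintype.card K) {n : ℕ} {F : MvPolynomial (Fin (n + 1)) K} (hF : F ≠ 0)
    (hhom : F.IsHomogeneous d) :
    Fintype.card K * #{v | eval v F = 0}
      ≤ Fintype.card K ^ n * ((Fintype.card K - 1) * d + 1) := by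
  have hq : 1 < Fintype.card K := Fintype.one_lt_card
  set q := Fintype.card K with hqK
  have hdK' : (d : Cardinal) ≤ Cardinal.mk K := by simpa using hdK
  obtain ⟨r, hr⟩ : ∃ r, q = r + 1 := ⟨q - 1, by omega⟩
  induction n with
  | zero =>
    have hcard : #{v | eval v F = 0} ≤ 1 := by
      refine Finset.card_le_one_iff_subset_singleton.2 ⟨0, fun v hv => ?_⟩
      by_contra hv0
      refine hF (hhom.eq_zero_of_forall_eval_eq_zero_of_le_card (fun w => ?_) hdK')
      have h0 : v 0 ≠ 0 := fun h => hv0 (by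
        rw [Finset.mem_singleton]; ext i; rw [Fin.fin_one_eq_zero i, h]; rfl)
      have hw : w = (w 0 / v 0) • v := by
        ext i; rw [Fin.fin_one_eq_zero i]; simp [h0]
      rw [hw, hhom.eval_smul_eq, (Finset.mem_filter.1 hv).2, mul_zero]
    rw [pow_zero, one_mul, hr, Nat.add_sub_cancel]
    calc (r + 1) * #{v | eval v F = 0} ≤ (r + 1) * 1 := by gcongr
      _ ≤ r * d + 1 := by nlinarith
  | succ n ih =>
    by_cases hplane : ∃ a : Fin (n + 2) → K, a ≠ 0 ∧ ∀ v, a ⬝ᵥ v = 0 → eval v F = 0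
    · obtain ⟨a, ha, hav⟩ := hplane
      obtain ⟨A, hA⟩ := exists_linearEquiv_dotProduct_eq ha
      obtain ⟨G, hG, hGA⟩ := hhom.exists_eval_comp A.toLinearMap
      have hcard : #{v | eval v F = 0} = #{v | eval v G = 0} :=
        (Finset.card_equiv A.toEquiv fun v => by simp [hGA]).symm
      have hG0 : G ≠ 0 := by
        rintro rfl
        refine hF (hhom.eq_zero_of_forall_eval_eq_zero_of_le_card (fun w => ?_) hdK')
        simpa using (hGA (A.symm w)).symm
      have hcoeff : (finSuccEquiv K (n + 1) G).coeff 0 = 0 := by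
        refine (hG.finSuccEquiv_coeff_isHomogeneous 0 d (zero_add d)
          ).eq_zero_of_forall_eval_eq_zero_of_le_card (fun s => ?_) hdK'
        rw [← Polynomial.coeff_map, Polynomial.coeff_zero_eq_eval_zero, ← eval_eq_eval_mv_eval',
          hGA]
        exact hav _ (by simp [hA])
      rw [hcard, card_filter_eq_sum_card_cons, ← Finset.add_sum_erase _ _ (Finset.mem_univ 0),
        mul_add, Finset.mul_sum]
      have hzero : #{s | eval (Fin.cons 0 s : Fin (n + 2) → K) G = 0} ≤ q ^ (n + 1) :=
        (Finset.card_le_univ _).trans (by simp [hqK])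
      have hsum := Finset.sum_le_card_nsmul (univ.erase (0 : K))
        (fun c => q * #{s | eval (Fin.cons c s : Fin (n + 2) → K) G = 0})
        ((d - 1) * q ^ (n + 1)) fun c hc => by
          rw [mul_comm]
          exact card_zeros_cons_mul_card_le hG0 hdK hG hcoeff (Finset.ne_of_mem_erase hc)
      rw [Finset.card_erase_of_mem (Finset.mem_univ _), Finset.card_univ, smul_eq_mul] at hsum
      refine (add_le_add (Nat.mul_le_mul_left q hzero) hsum).trans_eq ?_
      rw [← hqK, hr, Nat.add_sub_cancel]
      obtain ⟨k, rfl⟩ : ∃ k, d = k + 1 := ⟨d - 1, by omega⟩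
      rw [Nat.add_sub_cancel]
      ring
    · push Not at hplane
      have hsection : ∀ a ∈ univ.erase (0 : Fin (n + 2) → K),
          q * #{v ∈ ({v | eval v F = 0} : Finset (Fin (n + 2) → K)) | a ⬝ᵥ v = 0}
            ≤ q ^ n * ((q - 1) * d + 1) := by
        intro a ha
        have ha0 := Finset.ne_of_mem_erase ha
        obtain ⟨A, hA⟩ := exists_linearEquiv_dotProduct_eq ha0
        obtain ⟨G, hG, hGA⟩ := hhom.exists_eval_comp A.toLinearMap
        have hH := hG.finSuccEquiv_coeff_isHomogeneous 0 d (zero_add d)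
        have hHeval (s) : eval s ((finSuccEquiv K (n + 1) G).coeff 0)
            = eval (Fin.cons 0 s : Fin (n + 2) → K) G := by
          rw [← Polynomial.coeff_map, Polynomial.coeff_zero_eq_eval_zero,
            ← eval_eq_eval_mv_eval']
        have hH0 : (finSuccEquiv K (n + 1) G).coeff 0 ≠ 0 := by
          intro h
          obtain ⟨v, hav, hv⟩ := hplane a ha0
          obtain ⟨w, rfl⟩ := A.surjective v
          rw [hA] at hav
          refine hv ?_
          have hw := hHeval (Fin.tail w)
          rw [h, map_zero, show (Fin.cons 0 (Fin.tail w) : Fin (n + 2) → K) = w by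
            rw [← hav, Fin.cons_self_tail], hGA] at hw
          exact hw.symm
        have hle := ih hH0 hH
        simp only [hHeval] at hle
        rw [← card_filter_apply_zero_eq_zero_and (fun v => eval v G = 0)] at hle
        convert! hle using 2
        rw [Finset.filter_filter]
        refine (Finset.card_equiv A.toEquiv fun v => ?_).symm
        simp [hGA, hA]
      have hsum := Finset.sum_le_card_nsmul _ _ _ hsection
      have h0 : (0 : Fin (n + 2) → K) ∈ ({v | eval v F = 0} : Finset (Fin (n + 2) → K)) := by
        have h := hhom.eval_smul_eq 0 0
        rw [zero_smul, zero_pow (by omega), zero_mul] at h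
        simpa using h
      rw [← Finset.mul_sum, sum_card_filter_dotProduct h0,
        Finset.card_erase_of_mem (Finset.mem_univ _), Finset.card_univ, Fintype.card_fun,
        Fintype.card_fin, smul_eq_mul, ← hqK, show q ^ (n + 1 + 1) = q ^ 2 * q ^ n by ring,
        pow_succ' q n] at hsum
      have hM : (q - 1) * d + 1 ≤ q ^ 2 := by
        have : (q - 1) * d ≤ r * q := by
          rw [hr, Nat.add_sub_cancel, ← hr]; gcongr
        nlinarith
      have := le_of_incidence_le hq (by positivity) hM hsum
      calc q * #{v | eval v F = 0} ≤ q * (q ^ n * ((q - 1) * d + 1)) := by gcongr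
        _ = q ^ (n + 1) * ((q - 1) * d + 1) := by ring

/-- The affine cone over a set of projective points, with its apex removed. -/
theorem card_filter_ne_zero_eq_ncard_mul [Fintype K] [DecidableEq K] {n d : ℕ}
    {F : MvPolynomial (Fin n) K} (hhom : F.IsHomogeneous d) :
    #{v | eval v F = 0 ∧ v ≠ 0}
      = Set.ncard {x : Projectivization K (Fin n → K) | eval x.rep F = 0}
        * (Fintype.card K - 1) := by
  classical
  have := Fintype.ofFinite (Projectivization K (Fin n → K))
  rw [Set.ncard_eq_toFinset_card', ← Fintype.card_units, ← Finset.card_univ,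
    ← Finset.card_product]
  symm
  refine Finset.card_bij (fun p _ => p.2 • p.1.rep) ?_ ?_ ?_
  · rintro ⟨x, u⟩ hx
    have hx' : eval x.rep F = 0 := by simpa using hx
    have : eval (u • x.rep) F = 0 := by
      rw [Units.smul_def, hhom.eval_smul_eq, hx', mul_zero]
    exact Finset.mem_filter.2 ⟨Finset.mem_univ _, this, (smul_ne_zero_iff_ne u).2 x.rep_nonzero⟩
  · rintro ⟨x, u⟩ _ ⟨y, w⟩ _ (h : u • x.rep = w • y.rep)
    obtain rfl : x = y := by
      rw [← x.mk_rep, ← y.mk_rep, Projectivization.mk_eq_mk_iff]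
      exact ⟨u⁻¹ * w, by rw [mul_smul, ← h, inv_smul_smul]⟩
    have := smul_left_injective K x.rep_nonzero h
    rw [Units.ext this]
  · intro v hv
    obtain ⟨-, hv, hv0⟩ := Finset.mem_filter.1 hv
    obtain ⟨u, hu⟩ := Projectivization.exists_smul_eq_mk_rep K v hv0
    refine ⟨(Projectivization.mk K v hv0, u⁻¹), ?_, ?_⟩
    · simp [← hu, Units.smul_def, hhom.eval_smul_eq, hv]
    · simp [← hu]

end HomogeneousZeros

/-- Serre's bound: a projective hypersurface of degree `δ` in `ℙ^n` over `𝔽_q`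
has at most `δ·q^(n-1) + (q^(n-1) - 1)/(q - 1)` rational points. -/
theorem serre_bound_hypersurface
    (K : Type*) [Field K] [Fintype K] (q n δ : ℕ)
    (hq : Fintype.card K = q) (hn : 1 ≤ n) (hδ : 1 ≤ δ)
    (F : MvPolynomial (Fin (n + 1)) K) (hF : F ≠ 0)
    (hhom : F.IsHomogeneous δ) :
    Set.ncard {x : Projectivization K (Fin (n + 1) → K) | MvPolynomial.eval x.rep F = 0}
      ≤ δ * q ^ (n - 1) + (q ^ (n - 1) - 1) / (q - 1) := by
  classical
  subst hq
  have hq : 1 < Fintype.card K := Fintype.one_lt_card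
  obtain ⟨m, rfl⟩ : ∃ m, n = m + 1 := ⟨n - 1, by omega⟩
  have hcone : Fintype.card K * #{v | eval v F = 0}
      ≤ Fintype.card K ^ (m + 1) * ((Fintype.card K - 1) * δ + 1) := by
    rcases le_or_gt δ (Fintype.card K) with h | h
    · exact mul_card_zeros_le hδ h hF hhom
    · have hcard : #{v | eval v F = 0} ≤ Fintype.card K ^ (m + 2) :=
        (Finset.card_le_univ _).trans (by simp)
      obtain ⟨r, hr⟩ : ∃ r, Fintype.card K = r + 1 := ⟨Fintype.card K - 1, by omega⟩
      rw [hr] at hcard h ⊢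
      calc (r + 1) * #{v | eval v F = 0} ≤ (r + 1) * (r + 1) ^ (m + 2) := by gcongr
        _ = (r + 1) ^ (m + 1) * (r * (r + 2) + 1) := by ring
        _ ≤ (r + 1) ^ (m + 1) * ((r + 1 - 1) * δ + 1) := by
          rw [Nat.add_sub_cancel]
          gcongr
          omega
  have h0 : #{v | eval v F = 0} = #{v | eval v F = 0 ∧ v ≠ 0} + 1 := by
    have hmem : (0 : Fin (m + 1 + 1) → K) ∈ ({v | eval v F = 0} : Finset _) := by
      have h := hhom.eval_smul_eq 0 0
      rw [zero_smul, zero_pow (by omega), zero_mul] at h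
      simpa using h
    rw [← Finset.card_erase_add_one hmem]
    congr 2
    ext v
    simp [and_comm]
  rw [h0, card_filter_ne_zero_eq_ncard_mul hhom, pow_succ', mul_assoc] at hcone
  have hcone' := Nat.le_of_mul_le_mul_left hcone (by omega)
  rw [Nat.add_sub_cancel, ← Nat.sub_le_iff_le_add', Nat.le_div_iff_mul_le (by omega),
    Nat.sub_mul]
  rw [mul_add, mul_one, show Fintype.card K ^ m * ((Fintype.card K - 1) * δ)
    = δ * Fintype.card K ^ m * (Fintype.card K - 1) by ring] at hcone'
  omega
end

section
/- Let q be a prime power, n ≥ 1 an integer, r ≥ 2, and let L_1, …, L_r be linear subspaces of F_q^{n+1} with dimensions d_1 + 1 ≥ d_2 + 1 ≥ … ≥ d_r + 1, where each 0 ≤ d_i ≤ n. For each i let P(L_i) = { [v] ∈ ℙ(F_q^{n+1}) : v ∈ L_i, v ≠ 0 }. Then the cardinality of the union P(L_1) ∪ … ∪ P(L_r) is at most π_{d_1} + Σ_{i=2}^{r} (π_{d_i} − π_{d_i + d_1 − n}). -/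
/-- `ppi q j` is the number of rational points `π_j = (q^(j+1) - 1)/(q - 1)` of the
projective space `ℙ^j` over `𝔽_q` for `j ≥ 0`, and `0` for `j < 0`. -/
def ppi (q : ℕ) (j : ℤ) : ℕ :=
  if 0 ≤ j then (q ^ (j.toNat + 1) - 1) / (q - 1) else 0

/-- The set of points of the projective space `ℙ(V)` lying on the linear subvariety `ℙ(W)`. -/
def linearSubvariety {K V : Type*} [Field K] [AddCommGroup V] [Module K V]
    (W : Submodule K V) : Set (Projectivization K V) :=
  {x | ∃ (v : V) (hv : v ≠ 0), v ∈ W ∧ x = Projectivization.mk K v hv}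

section LinearSubvariety

variable {K V : Type*} [Field K] [AddCommGroup V] [Module K V]

theorem mk_mem_linearSubvariety {W : Submodule K V} {v : V} (hv : v ≠ 0) :
    Projectivization.mk K v hv ∈ linearSubvariety W ↔ v ∈ W := by
  refine ⟨?_, fun h => ⟨v, hv, h, rfl⟩⟩
  rintro ⟨w, hw, hwW, h⟩
  obtain ⟨a, rfl⟩ := (Projectivization.mk_eq_mk_iff K _ _ hv hw).1 h
  exact W.smul_mem _ hwW

theorem linearSubvariety_eq_range_map (W : Submodule K V) :
    linearSubvariety W =
      Set.range (Projectivization.map W.subtype W.subtype_injective) := by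
  ext x
  constructor
  · rintro ⟨v, hv, hvW, rfl⟩
    exact ⟨Projectivization.mk K ⟨v, hvW⟩ (by simpa using hv), rfl⟩
  · rintro ⟨y, rfl⟩
    induction y using Projectivization.ind with
    | h w hw => exact ⟨w, by simpa using hw, w.2, rfl⟩

theorem linearSubvariety_inf (W W' : Submodule K V) :
    linearSubvariety (W ⊓ W') = linearSubvariety W ∩ linearSubvariety W' := by
  ext x
  induction x using Projectivization.ind with
  | h v hv => simp [mk_mem_linearSubvariety]

theorem ncard_linearSubvariety [Finite K] (W : Submodule K V) :
    (linearSubvariety W).ncard =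
      ∑ i ∈ Finset.range (Module.finrank K W), Nat.card K ^ i := by
  rw [linearSubvariety_eq_range_map, ← Set.image_univ,
    Set.ncard_image_of_injective _ (Projectivization.map_injective _ _), Set.ncard_univ,
    Projectivization.card_of_finrank K W rfl]

end LinearSubvariety

theorem ppi_eq_sum_range {q : ℕ} (hq : 2 ≤ q) (j : ℤ) :
    ppi q j = ∑ i ∈ Finset.range (j + 1).toNat, q ^ i := by
  unfold ppi
  split_ifs with h
  · rw [Nat.geomSum_eq hq, show (j + 1).toNat = j.toNat + 1 by omega]
  · rw [show (j + 1).toNat = 0 by omega, Finset.sum_range_zero]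

theorem Set.ncard_iUnion_le_add_sum_diff {ι α : Type*} [Fintype ι] [DecidableEq ι] [Finite α]
    (s : ι → Set α) (i₀ : ι) :
    (⋃ i, s i).ncard ≤ (s i₀).ncard + ∑ i ∈ Finset.univ.erase i₀, (s i \ s i₀).ncard := by
  have hsub : (⋃ i, s i) ⊆ s i₀ ∪ ⋃ i ∈ Finset.univ.erase i₀, s i \ s i₀ := by
    intro x hx
    obtain ⟨i, hi⟩ := Set.mem_iUnion.1 hx
    by_cases h₀ : x ∈ s i₀
    · exact Or.inl h₀
    · have hne : i ≠ i₀ := by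
        rintro rfl
        exact h₀ hi
      exact Or.inr (Set.mem_biUnion (by simpa using hne) ⟨hi, h₀⟩)
  calc (⋃ i, s i).ncard ≤ _ := Set.ncard_le_ncard hsub
    _ ≤ _ := Set.ncard_union_le _ _
    _ ≤ _ := Nat.add_le_add_left (Finset.set_ncard_biUnion_le _ _) _

/-- Proposition 5.6: a union of `r ≥ 2` linear subvarieties of `ℙ^n` over `𝔽_q`, of
dimensions `d_1 ≥ d_2 ≥ … ≥ d_r`, has at most
`π_{d_1} + Σ_{i=2}^r (π_{d_i} − π_{d_i + d_1 − n})` rational points. -/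
theorem bound_union_linear_subvarieties_sorted
    (K : Type*) [Field K] [Fintype K] (q n r : ℕ)
    (hq : Fintype.card K = q) (hn : 1 ≤ n) (hr : 2 ≤ r)
    (d : Fin r → ℕ) (hdn : ∀ i, d i ≤ n)
    (hsorted : ∀ i j : Fin r, i ≤ j → d j ≤ d i)
    (L : Fin r → Submodule K (Fin (n + 1) → K))
    (hdim : ∀ i, Module.finrank K (L i) = d i + 1) :
    Set.ncard (⋃ i, {x : Projectivization K (Fin (n + 1) → K) |
        ∃ (v : Fin (n + 1) → K) (hv : v ≠ 0), v ∈ L i ∧ x = Projectivization.mk K v hv})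
      ≤ ppi q (d ⟨0, by omega⟩) +
        ∑ i ∈ Finset.univ.erase (⟨0, by omega⟩ : Fin r),
          (ppi q (d i) - ppi q (d i + d ⟨0, by omega⟩ - n)) := by
  classical
  have hK : Nat.card K = q := by rw [Nat.card_eq_fintype_card, hq]
  have hq2 : 2 ≤ q := hq ▸ Fintype.one_lt_card
  have hcard (i : Fin r) : (linearSubvariety (L i)).ncard = ppi q (d i) := by
    rw [ncard_linearSubvariety, ppi_eq_sum_range hq2, hdim, hK]
    congr 1
  set i₀ : Fin r := ⟨0, by omega⟩
  have hinter (i : Fin r) :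
      ppi q (d i + d i₀ - n) ≤ (linearSubvariety (L i) ∩ linearSubvariety (L i₀)).ncard := by
    rw [← linearSubvariety_inf, ncard_linearSubvariety, ppi_eq_sum_range hq2, hK]
    refine Finset.sum_le_sum_of_subset (Finset.range_subset_range.2 ?_)
    have hsum := Submodule.finrank_sup_add_finrank_inf_eq (L i) (L i₀)
    have hsup := Submodule.finrank_le (L i ⊔ L i₀)
    rw [Module.finrank_fin_fun] at hsup
    rw [hdim, hdim] at hsum
    omega
  refine (Set.ncard_iUnion_le_add_sum_diff (fun i => linearSubvariety (L i)) i₀).trans ?_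
  refine Nat.add_le_add (hcard i₀).le ?_
  refine Finset.sum_le_sum fun i _ => ?_
  have hdiff := Set.ncard_inter_add_ncard_sdiff_eq_ncard
    (linearSubvariety (L i)) (linearSubvariety (L i₀))
  have := hinter i
  rw [hcard] at hdiff
  omega
end
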